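/- Let m ≥ 2 be an integer, a an integer with 0 ≤ a ≤ m−2, and q complex with 0 < |q| < 1. Then Σ_{k=0}^{∞} [ (2mk + m−1−a) q^{m k² + (m−1−a)k} − (2mk + m+1+a) q^{m k² + (m+1+a)k + 1 + a} ] = Σ_{c_1,…,c_{m−1}=0}^{∞} ( 2(c_1 + ⋯ + c_{m−1}) + m−1−a ) · (−1)^{c_{m−1}} q^{c_{m−1}(c_{m−1}+1)/2} q^{c_1²+⋯+c_{m−2}² + c_{a+1}+⋯+c_{m−2}} Π_{i=1}^{m−2} [c_{i+1}+δ_{i,a} choose c_i]_q. -/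

import Mathlib

open scoped BigOperators

/-- The Gaussian binomial coefficient `[M choose n]_q`: equal to
`(q)_M/((q)_n (q)_{M−n})` for `M ≥ n ≥ 0` and to `0` otherwise; defined via the
`q`-Pascal recursion (hence an integer polynomial in `q`). -/
def qBinom (q : ℂ) : ℕ → ℕ → ℂ
  | _, 0 => 1
  | 0, _ + 1 => 0
  | M + 1, n + 1 => q ^ (n + 1) * qBinom q M (n + 1) + qBinom q M n

/-- The general term of the multiple series `K_m^{(a)}(x)` with `m = p + 2`:
for `c : Fin (p+1) → ℕ` (where `c j` is `c_{j+1}`, `j = 0,…,p`), the term is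
`(−1)^{c_{m−1}} q^{c_{m−1}(c_{m−1}+1)/2} x^{c_1+⋯+c_{m−1}}
 q^{c_1²+⋯+c_{m−2}² + c_{a+1}+⋯+c_{m−2}} Π_{i=1}^{m−2} [c_{i+1}+δ_{i,a} choose c_i]_q`. -/
noncomputable def Kterm (p a : ℕ) (q x : ℂ) (c : Fin (p + 1) → ℕ) : ℂ :=
  (-1 : ℂ) ^ (c (Fin.last p)) *
    q ^ ((c (Fin.last p) * (c (Fin.last p) + 1)) / 2) *
    x ^ (∑ j : Fin (p + 1), c j) *
    q ^ ((∑ j : Fin p, (c j.castSucc) ^ 2) +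
          ∑ j : Fin p, (if a ≤ (j : ℕ) then c j.castSucc else 0)) *
    ∏ j : Fin p,
      qBinom q (c j.succ + (if (j : ℕ) + 1 = a then 1 else 0)) (c j.castSucc)

open PowerSeries

section gaussian

variable (q : ℂ)

theorem qBinom_zero_right (n : ℕ) : qBinom q n 0 = 1 := by
  cases n <;> simp [qBinom]

theorem qBinom_succ_succ (n r : ℕ) :
    qBinom q (n + 1) (r + 1) = q ^ (r + 1) * qBinom q n (r + 1) + qBinom q n r := by
  simp [qBinom]

theorem qBinom_eq_zero {n r : ℕ} (h : n < r) : qBinom q n r = 0 := by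
  induction n generalizing r with
  | zero => cases r with
    | zero => omega
    | succ r => simp [qBinom]
  | succ n ih => cases r with
    | zero => omega
    | succ r => rw [qBinom_succ_succ, ih (by omega), ih (by omega)]; simp

theorem qBinom_self (n : ℕ) : qBinom q n n = 1 := by
  induction n with
  | zero => simp [qBinom]
  | succ n ih => rw [qBinom_succ_succ, ih, qBinom_eq_zero q (Nat.lt_succ_self n)]; simp

/-- The second `q`-Pascal rule. -/
theorem qBinom_succ_succ' (r d : ℕ) :
    qBinom q (r + d + 1) (r + 1) = qBinom q (r + d) (r + 1) + q ^ d * qBinom q (r + d) r := by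
  induction d generalizing r with
  | zero => simp [qBinom_self, qBinom_eq_zero]
  | succ d ih =>
    induction r with
    | zero =>
      have h := ih 0
      have h1 := qBinom_succ_succ q (d + 1) 0
      have h2 := qBinom_succ_succ q d 0
      simp only [zero_add, qBinom_zero_right] at h h1 h2 ⊢
      linear_combination h1 + q * h - h2
    | succ r ihr =>
      have e : r + 1 + (d + 1) = r + 1 + d + 1 := by ring
      rw [show r + (d + 1) = r + 1 + d by ring] at ihr
      rw [e]
      linear_combination qBinom_succ_succ q (r + 1 + d + 1) (r + 1) + q ^ (r + 2) * ih (r + 1)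
        - qBinom_succ_succ q (r + 1 + d) (r + 1) + ihr
        - q ^ (d + 1) * qBinom_succ_succ q (r + 1 + d) r

theorem qBinom_absorb (r d : ℕ) :
    (1 - q ^ (r + 1)) * qBinom q (r + d) (r + 1) = (1 - q ^ d) * qBinom q (r + d) r := by
  linear_combination qBinom_succ_succ q (r + d) r - qBinom_succ_succ' q r d

theorem norm_qBinom_le (hq : ‖q‖ < 1) (n r : ℕ) : ‖qBinom q n r‖ ≤ ((1 - ‖q‖)⁻¹) ^ r := by
  have h0 : 0 < 1 - ‖q‖ := by linarith
  induction n generalizing r with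
  | zero => cases r with
    | zero => simp [qBinom]
    | succ r => simp only [qBinom, norm_zero]; positivity
  | succ n ih => cases r with
    | zero => simp [qBinom]
    | succ r =>
      rw [qBinom_succ_succ]
      calc _ ≤ ‖q‖ ^ (r + 1) * ‖qBinom q n (r + 1)‖ + ‖qBinom q n r‖ := by
            refine (norm_add_le _ _).trans ?_
            rw [norm_mul, norm_pow]
        _ ≤ ‖q‖ * ((1 - ‖q‖)⁻¹) ^ (r + 1) + ((1 - ‖q‖)⁻¹) ^ r := by
            gcongr
            · exact pow_le_of_le_one (norm_nonneg q) hq.le (by omega)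
            · exact ih _
            · exact ih _
        _ = ((1 - ‖q‖)⁻¹) ^ (r + 1) := by
            rw [pow_succ]; field_simp; ring

end gaussian

section bailey

variable (q : ℂ)

/-- The inverse of `∏_{i=0}^{n} (1 - y q^{r+i})`. -/
noncomputable def invPoch (y : ℂ⟦X⟧) (r n : ℕ) : ℂ⟦X⟧ :=
  (∏ i ∈ Finset.range (n + 1), (1 - y * C q ^ (r + i)))⁻¹

/-- The Bailey-type basis `[n choose r]_q / ∏_{i=0}^{n} (1 - y q^{r+i})`. -/
noncomputable def baileyBasis (y : ℂ⟦X⟧) (r n : ℕ) : ℂ⟦X⟧ :=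
  C (qBinom q n r) * invPoch q y r n

theorem one_sub_mul_inv {y : ℂ⟦X⟧} (hy : constantCoeff y = 0) (z : ℂ⟦X⟧) :
    (1 - y * z) * (1 - y * z)⁻¹ = 1 :=
  PowerSeries.mul_inv_cancel _ (by simp [hy])

theorem invPoch_eq_succ {y : ℂ⟦X⟧} (hy : constantCoeff y = 0) (r n : ℕ) :
    invPoch q y r n = (1 - y * C q ^ (r + n + 1)) * invPoch q y r (n + 1) := by
  unfold invPoch
  rw [Finset.prod_range_succ _ (n + 1), PowerSeries.mul_inv_rev, ← mul_assoc, ← add_assoc,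
    one_sub_mul_inv hy, one_mul]

theorem invPoch_mul_left (y : ℂ⟦X⟧) (r n : ℕ) :
    invPoch q (y * C q) r n = invPoch q y (r + 1) n := by
  unfold invPoch
  congr 1
  refine Finset.prod_congr rfl fun i _ => ?_
  ring

theorem invPoch_succ_left {y : ℂ⟦X⟧} (hy : constantCoeff y = 0) (r n : ℕ) :
    invPoch q y (r + 1) n = (1 - y * C q ^ r) * invPoch q y r (n + 1) := by
  unfold invPoch
  rw [Finset.prod_range_succ' _ (n + 1), PowerSeries.mul_inv_rev, ← mul_assoc, add_zero,
    one_sub_mul_inv hy, one_mul]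
  congr 1
  refine Finset.prod_congr rfl fun i _ => ?_
  ring

theorem baileyBasis_eq_zero (y : ℂ⟦X⟧) {r n : ℕ} (h : n < r) : baileyBasis q y r n = 0 := by
  simp [baileyBasis, qBinom_eq_zero q h]

theorem baileyBasis_zero_succ {y : ℂ⟦X⟧} (hy : constantCoeff y = 0) (n : ℕ) :
    (1 - y) * baileyBasis q y 0 (n + 1) = baileyBasis q (y * C q) 0 n := by
  simp only [baileyBasis, qBinom_zero_right, invPoch_mul_left, invPoch_succ_left q hy]
  simp

theorem baileyBasis_succ_succ {y : ℂ⟦X⟧} (hy : constantCoeff y = 0) (r n : ℕ) :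
    (1 - y * C q ^ (2 * (r + 1))) * baileyBasis q y (r + 1) (n + 1) =
      C q ^ (r + 1) * baileyBasis q (y * C q) (r + 1) n + baileyBasis q (y * C q) r n := by
  rcases lt_or_ge n r with h | h
  · simp [baileyBasis_eq_zero, h, Nat.lt_succ_of_lt h]
  obtain ⟨d, rfl⟩ := Nat.exists_eq_add_of_le h
  have h1 := congrArg C (qBinom_succ_succ q (r + d) r)
  have h2 := congrArg C (qBinom_succ_succ' q r d)
  simp only [map_add, map_mul, map_pow] at h1 h2
  simp only [baileyBasis, invPoch_mul_left]
  rw [invPoch_succ_left q hy (r + 1), invPoch_eq_succ q hy (r + 1) (r + d)]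
  linear_combination invPoch q y (r + 1) (r + d + 1) *
    (h1 - y * C q ^ (2 * (r + 1)) * h2)

theorem baileyBasis_succ_sub {y : ℂ⟦X⟧} (hy : constantCoeff y = 0) (r n : ℕ) :
    (1 - y * C q ^ (2 * (r + 1))) * C q ^ (r + 1) *
        (baileyBasis q y (r + 1) (n + 1) - baileyBasis q y (r + 1) n) =
      C q ^ (n + 1) * (y * C q ^ (3 * (r + 1)) *
        baileyBasis q (y * C q) (r + 1) n + baileyBasis q (y * C q) r n) := by
  rcases lt_or_ge n r with h | h
  · simp [baileyBasis_eq_zero, h, Nat.lt_succ_of_lt h]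
  obtain ⟨d, rfl⟩ := Nat.exists_eq_add_of_le h
  have h1 := congrArg C (qBinom_absorb q r d)
  have h2 := congrArg C (qBinom_succ_succ' q r d)
  simp only [map_add, map_mul, map_pow, map_sub, map_one] at h1 h2
  simp only [baileyBasis, invPoch_mul_left]
  rw [invPoch_succ_left q hy (r + 1), invPoch_eq_succ q hy (r + 1) (r + d)]
  linear_combination invPoch q y (r + 1) (r + d + 1) * C q ^ (r + 1) *
    ((1 - y * C q ^ (2 * (r + 1))) * h2 + y * C q ^ (d + 2 * r + 2) * h1)

theorem sum_mul_baileyBasis {y : ℂ⟦X⟧} (hy : constantCoeff y = 0) (r n R : ℕ) (hn : n < R) :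
    ∑ s ∈ Finset.range R, y ^ s * C q ^ s ^ 2 * C (qBinom q n s) * baileyBasis q y r s =
      y ^ r * C q ^ r ^ 2 * baileyBasis q y r n := by
  induction n generalizing y r R with
  | zero =>
    rw [Finset.sum_eq_single_of_mem 0 (Finset.mem_range.2 hn)]
    · cases r with
      | zero => simp [qBinom]
      | succ r => simp [baileyBasis_eq_zero]
    · intro s _ hs
      simp [qBinom_eq_zero q (Nat.pos_of_ne_zero hs)]
  | succ n ih =>
    obtain ⟨R, rfl⟩ : ∃ R', R = R' + 1 := ⟨R - 1, by omega⟩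
    have hyq : constantCoeff (y * C q) = 0 := by simp [hy]
    have key : ∑ s ∈ Finset.range (R + 1),
          y ^ s * C q ^ s ^ 2 * C (qBinom q (n + 1) s) * baileyBasis q y r s =
        ∑ s ∈ Finset.range (R + 1),
          y ^ s * C q ^ s ^ 2 * C (qBinom q n s) * baileyBasis q y r s +
        y * C q ^ (n + 1) * ∑ s ∈ Finset.range R,
          (y * C q) ^ s * C q ^ s ^ 2 * C (qBinom q n s) * baileyBasis q y r (s + 1) := by
      rw [Finset.sum_range_succ', Finset.sum_range_succ' _ R, Finset.mul_sum, add_right_comm,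
        ← Finset.sum_add_distrib]
      simp only [qBinom_zero_right]
      congr 1
      refine Finset.sum_congr rfl fun s _ => ?_
      rcases lt_or_ge n s with h | h
      · simp [qBinom_eq_zero q h, qBinom_eq_zero q (Nat.lt_succ_of_lt h),
          qBinom_eq_zero q (Nat.succ_lt_succ h)]
      obtain ⟨d, rfl⟩ := Nat.exists_eq_add_of_le h
      have h2 := congrArg C (qBinom_succ_succ' q s d)
      simp only [map_add, map_mul, map_pow] at h2
      linear_combination y ^ (s + 1) * C q ^ (s + 1) ^ 2 * baileyBasis q y r (s + 1) * h2
    rw [key, ih hy r (R + 1) (by omega)]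
    cases r with
    | zero =>
      have hu : (1 - y) * (1 - y)⁻¹ = 1 := by simpa using one_sub_mul_inv hy 1
      have e1 := fun s => baileyBasis_zero_succ q hy s
      have e2 : (1 - y) * ∑ s ∈ Finset.range R,
          (y * C q) ^ s * C q ^ s ^ 2 * C (qBinom q n s) * baileyBasis q y 0 (s + 1) =
          baileyBasis q (y * C q) 0 n := by
        have := ih hyq 0 R (by omega)
        simp only [← e1, pow_zero, one_mul] at this
        rw [← e1, ← one_mul ((1 - y) * _), ← one_mul ((1 - y) * _)]
        simpa [Finset.mul_sum, mul_left_comm] using this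
      have e3 : (1 - y) * (baileyBasis q y 0 (n + 1) - baileyBasis q y 0 n) =
          y * C q ^ (n + 1) * baileyBasis q (y * C q) 0 n := by
        simp only [baileyBasis, qBinom_zero_right, invPoch_mul_left]
        rw [invPoch_succ_left q hy 0, invPoch_eq_succ q hy 0 n]
        simp
        ring
      linear_combination (1 - y)⁻¹ * (y * C q ^ (n + 1) * e2 - e3) -
        hu * (baileyBasis q y 0 n + y * C q ^ (n + 1) * ∑ s ∈ Finset.range R,
          (y * C q) ^ s * C q ^ s ^ 2 * C (qBinom q n s) * baileyBasis q y 0 (s + 1)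
          - baileyBasis q y 0 (n + 1))
    | succ r =>
      have hu := one_sub_mul_inv hy (C q ^ (2 * (r + 1)))
      have e2 : (1 - y * C q ^ (2 * (r + 1))) * ∑ s ∈ Finset.range R,
          (y * C q) ^ s * C q ^ s ^ 2 * C (qBinom q n s) * baileyBasis q y (r + 1) (s + 1) =
          C q ^ (r + 1) * ((y * C q) ^ (r + 1) * C q ^ (r + 1) ^ 2 *
            baileyBasis q (y * C q) (r + 1) n) +
          (y * C q) ^ r * C q ^ r ^ 2 * baileyBasis q (y * C q) r n := by
        rw [← ih hyq (r + 1) R (by omega), ← ih hyq r R (by omega), Finset.mul_sum, Finset.mul_sum,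
          ← Finset.sum_add_distrib]
        refine Finset.sum_congr rfl fun s _ => ?_
        linear_combination (y * C q) ^ s * C q ^ s ^ 2 * C (qBinom q n s) *
          baileyBasis_succ_succ q hy r s
      have e3 := baileyBasis_succ_sub q hy r n
      linear_combination (1 - y * C q ^ (2 * (r + 1)))⁻¹ * (y * C q ^ (n + 1) * e2
          - y ^ (r + 1) * C q ^ (r ^ 2 + r) * e3) -
        hu * (y ^ (r + 1) * C q ^ (r + 1) ^ 2 * baileyBasis q y (r + 1) n +
          y * C q ^ (n + 1) * ∑ s ∈ Finset.range R,
          (y * C q) ^ s * C q ^ s ^ 2 * C (qBinom q n s) * baileyBasis q y (r + 1) (s + 1)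
          - y ^ (r + 1) * C q ^ (r + 1) ^ 2 * baileyBasis q y (r + 1) (n + 1))

/-- The sign and power `(-1)^r q^{r(r-1)/2}`. -/
noncomputable def altCoeff (r : ℕ) : ℂ⟦X⟧ := (-1) ^ r * C q ^ r.choose 2

theorem altCoeff_succ (r : ℕ) : altCoeff q (r + 1) = -(C q ^ r * altCoeff q r) := by
  simp only [altCoeff, Nat.choose_succ_succ' r 1, Nat.choose_one_right]
  ring

theorem sum_altCoeff_succ {y : ℂ⟦X⟧} (hy : constantCoeff y = 0) (l : ℕ → ℂ⟦X⟧) (n R : ℕ)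
    (hn : n < R) :
    ∑ r ∈ Finset.range (R + 1), altCoeff q r * l r * (1 - y * C q ^ (2 * r)) *
        baileyBasis q y r (n + 1) =
      ∑ r ∈ Finset.range R, altCoeff q r * C q ^ r * (l r - l (r + 1)) *
        baileyBasis q (y * C q) r n := by
  have h : ∀ r ∈ Finset.range R, altCoeff q r * C q ^ r * (l r - l (r + 1)) *
        baileyBasis q (y * C q) r n =
      altCoeff q r * l r * C q ^ r * baileyBasis q (y * C q) r n +
      altCoeff q (r + 1) * l (r + 1) * baileyBasis q (y * C q) r n := by
    intro r _
    rw [altCoeff_succ]; ring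
  rw [Finset.sum_congr rfl h, Finset.sum_add_distrib]
  have h' : ∑ r ∈ Finset.range R, altCoeff q r * l r * C q ^ r * baileyBasis q (y * C q) r n =
      ∑ r ∈ Finset.range (R + 1),
        altCoeff q r * l r * C q ^ r * baileyBasis q (y * C q) r n := by
    rw [Finset.sum_range_succ, baileyBasis_eq_zero q _ hn]; simp
  rw [h', Finset.sum_range_succ', Finset.sum_range_succ' _ R, add_right_comm,
    ← Finset.sum_add_distrib]
  refine congrArg₂ (· + ·) (Finset.sum_congr rfl fun r _ => ?_) ?_
  · linear_combination altCoeff q (r + 1) * l (r + 1) * baileyBasis_succ_succ q hy r n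
  · have := baileyBasis_zero_succ q hy n
    simp only [mul_zero, pow_zero, mul_one]
    linear_combination altCoeff q 0 * l 0 * this

theorem sum_altCoeff_eq_one {y : ℂ⟦X⟧} (hy : constantCoeff y = 0) (n R : ℕ) (hn : n < R) :
    ∑ r ∈ Finset.range R, altCoeff q r * (y ^ r * C q ^ r ^ 2) * (1 - y * C q ^ (2 * r)) *
        baileyBasis q y r n = 1 := by
  induction n generalizing y R with
  | zero =>
    rw [Finset.sum_eq_single_of_mem 0 (Finset.mem_range.2 hn)]
    · have := one_sub_mul_inv hy 1
      simpa [altCoeff, baileyBasis, invPoch, qBinom] using this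
    · intro s _ hs
      simp [baileyBasis_eq_zero q _ (Nat.pos_of_ne_zero hs)]
  | succ n ih =>
    obtain ⟨R, rfl⟩ : ∃ R', R = R' + 1 := ⟨R - 1, by omega⟩
    rw [sum_altCoeff_succ q hy _ n R (by omega), ← ih (y := y * C q) (by simp [hy]) R (by omega)]
    refine Finset.sum_congr rfl fun r _ => ?_
    ring

/-- The weights `(-1)^n q^{n(n+1)/2} x^n` of the last summation variable. -/
noncomputable def lastWeight (n : ℕ) : ℂ⟦X⟧ := (-1) ^ n * C q ^ (n + 1).choose 2 * X ^ n

theorem lastWeight_succ (n : ℕ) :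
    lastWeight q (n + 1) = -(X * C q ^ (n + 1) * lastWeight q n) := by
  simp only [lastWeight, Nat.choose_succ_succ' (n + 1) 1, Nat.choose_one_right]
  ring

theorem X_pow_dvd_lastWeight (n : ℕ) : X ^ n ∣ lastWeight q n := Dvd.intro_left _ rfl

theorem X_pow_dvd_sum_lastWeight (r M : ℕ) :
    X ^ M ∣ ∑ n ∈ Finset.range M, lastWeight q n * baileyBasis q (X * C q) r n -
      lastWeight q r := by
  have hX : constantCoeff (X * C q : ℂ⟦X⟧) = 0 := by simp
  induction r with
  | zero =>
    have h : ∑ n ∈ Finset.range M, lastWeight q n * baileyBasis q (X * C q) 0 n - lastWeight q 0 =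
        -(lastWeight q M * (∏ i ∈ Finset.range M, (1 - X * C q * C q ^ i))⁻¹) := by
      induction M with
      | zero => simp [lastWeight]
      | succ M ih =>
        have e : (∏ i ∈ Finset.range M, (1 - X * C q * C q ^ i))⁻¹ =
            (1 - X * C q * C q ^ M) * invPoch q (X * C q) 0 M := by
          unfold invPoch
          simp only [zero_add]
          rw [Finset.prod_range_succ _ M, PowerSeries.mul_inv_rev, ← mul_assoc,
            one_sub_mul_inv hX, one_mul]
        have e' : (∏ i ∈ Finset.range (M + 1), (1 - X * C q * C q ^ i))⁻¹ =
            invPoch q (X * C q) 0 M := by simp [invPoch]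
        rw [Finset.sum_range_succ, add_sub_right_comm, ih, e, e', lastWeight_succ, baileyBasis,
          qBinom_zero_right, map_one]
        ring
    rw [h]
    exact (dvd_neg.2 ((X_pow_dvd_lastWeight q M).mul_right _))
  | succ r ih =>
    set g : ℕ → ℂ⟦X⟧ := fun n => C (qBinom q n (r + 1)) * invPoch q (X * C q) (r + 1) (n - 1) with hg
    have hrel : ∀ n, (1 - X * C q ^ (2 * r + 2)) * (X * C q ^ (n + 1) * g (n + 1) + g n) =
        (1 - X * C q ^ (r + 1)) * (baileyBasis q (X * C q) (r + 1) n +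
          X * C q ^ (r + 1) * baileyBasis q (X * C q) r n) := by
      intro n
      have hg0 : g n = C (qBinom q n (r + 1)) *
          ((1 - X * C q ^ (r + n + 2)) * invPoch q (X * C q) (r + 1) n) := by
        cases n with
        | zero => simp [hg, qBinom]
        | succ n =>
          simp only [hg, Nat.add_sub_cancel]
          rw [invPoch_eq_succ q hX]
          ring
      have hg1 : g (n + 1) = C (qBinom q (n + 1) (r + 1)) * invPoch q (X * C q) (r + 1) n := rfl
      have hI : (1 - X * C q ^ (r + 1)) * invPoch q (X * C q) r n =
          (1 - X * C q ^ (r + n + 2)) * invPoch q (X * C q) (r + 1) n := by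
        rw [invPoch_succ_left q hX, invPoch_eq_succ q hX r n]
        ring
      rw [hg0, hg1]
      simp only [baileyBasis]
      rcases lt_or_ge n r with h | h
      · simp [qBinom_eq_zero q h, qBinom_eq_zero q (Nat.lt_succ_of_lt h),
          qBinom_eq_zero q (Nat.succ_lt_succ h)]
      obtain ⟨d, rfl⟩ := Nat.exists_eq_add_of_le h
      have h1 := congrArg C (qBinom_absorb q r d)
      have h2 := congrArg C (qBinom_succ_succ' q r d)
      simp only [map_add, map_mul, map_pow, map_sub, map_one] at h1 h2
      linear_combination invPoch q (X * C q) (r + 1) (r + d) * X * C q ^ (r + 1) *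
        ((1 - X * C q ^ (2 * r + 2)) * C q ^ d * (h2 + h1) + h1) -
        X * C q ^ (r + 1) * C (qBinom q (r + d) r) * hI
    have htel : ∀ M, ∑ n ∈ Finset.range M, lastWeight q n * (X * C q ^ (n + 1) * g (n + 1) + g n) =
        -(lastWeight q M * g M) := by
      intro M
      induction M with
      | zero => simp [hg, qBinom]
      | succ M ih => rw [Finset.sum_range_succ, ih, lastWeight_succ]; ring
    have hu := one_sub_mul_inv (y := X) (by simp) (C q ^ (r + 1) : ℂ⟦X⟧)
    have hmain : (1 - X * C q ^ (r + 1)) * (∑ n ∈ Finset.range M, lastWeight q n *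
          baileyBasis q (X * C q) (r + 1) n - lastWeight q (r + 1)) =
        -((1 - X * C q ^ (2 * r + 2)) * (lastWeight q M * g M)) -
        (1 - X * C q ^ (r + 1)) * (X * C q ^ (r + 1)) *
          (∑ n ∈ Finset.range M, lastWeight q n * baileyBasis q (X * C q) r n -
            lastWeight q r) := by
      have h1 : (1 - X * C q ^ (2 * r + 2)) * ∑ n ∈ Finset.range M,
            lastWeight q n * (X * C q ^ (n + 1) * g (n + 1) + g n) =
          (1 - X * C q ^ (r + 1)) *
            (∑ n ∈ Finset.range M, lastWeight q n * baileyBasis q (X * C q) (r + 1) n +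
              X * C q ^ (r + 1) *
              ∑ n ∈ Finset.range M, lastWeight q n * baileyBasis q (X * C q) r n) := by
        rw [Finset.mul_sum, Finset.mul_sum, ← Finset.sum_add_distrib, Finset.mul_sum]
        refine Finset.sum_congr rfl fun n _ => ?_
        linear_combination lastWeight q n * hrel n
      rw [htel] at h1
      rw [lastWeight_succ]
      linear_combination -h1
    rw [← one_mul (_ - _), ← hu, mul_comm (1 - _) (_⁻¹), mul_assoc, hmain]
    exact (dvd_sub (dvd_neg.2 (((X_pow_dvd_lastWeight q M).mul_right _).mul_left _))
      (ih.mul_left _)).mul_left _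

end bailey

section chain

variable (q : ℂ)

/-- The sum over `c_1, …, c_p` with `c_{p+1} = n`, truncated to `c_i ≤ R` for `i ≤ a` and to
`c_i < R` for `i > a`, weighted by `X ^ (c_1 + ⋯ + c_p)`. -/
noncomputable def chainSum (R a : ℕ) : ℕ → ℕ → ℂ⟦X⟧
  | 0, _ => 1
  | p + 1, n => ∑ r ∈ Finset.range (if p < a then R + 1 else R),
      X ^ r * C q ^ (r ^ 2 + if a ≤ p then r else 0) *
        C (qBinom q (n + if p + 1 = a then 1 else 0) r) * chainSum R a p r

theorem sum_mul_sum_baileyBasis {y : ℂ⟦X⟧} (hy : constantCoeff y = 0) (l : ℕ → ℂ⟦X⟧)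
    (n R : ℕ) (hn : n < R) :
    ∑ s ∈ Finset.range R, y ^ s * C q ^ s ^ 2 * C (qBinom q n s) *
        ∑ r ∈ Finset.range R, l r * baileyBasis q y r s =
      ∑ r ∈ Finset.range R, l r * (y ^ r * C q ^ r ^ 2) * baileyBasis q y r n := by
  simp_rw [Finset.mul_sum]
  rw [Finset.sum_comm]
  refine Finset.sum_congr rfl fun r _ => ?_
  rw [mul_assoc, ← sum_mul_baileyBasis q hy r n R hn, Finset.mul_sum]
  refine Finset.sum_congr rfl fun s _ => ?_
  ring

theorem chainSum_of_lt (R a p n : ℕ) (hp : p < a) (hn : n ≤ R) :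
    chainSum q R a p n = ∑ r ∈ Finset.range (R + 1),
      altCoeff q r * (X ^ r * C q ^ r ^ 2) ^ (p + 1) * (1 - X * C q ^ (2 * r)) *
        baileyBasis q X r n := by
  induction p generalizing n with
  | zero =>
    simpa [chainSum] using (sum_altCoeff_eq_one q (y := X) (by simp) n (R + 1) (by omega)).symm
  | succ p ih =>
    rw [chainSum]
    simp only [if_pos (show p < a by omega), if_neg (show ¬a ≤ p by omega),
      if_neg (show p + 1 ≠ a by omega)]
    have h : ∀ s ∈ Finset.range (R + 1),
        X ^ s * C q ^ (s ^ 2 + 0) * C (qBinom q (n + 0) s) * chainSum q R a p s =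
        X ^ s * C q ^ s ^ 2 * C (qBinom q n s) * ∑ r ∈ Finset.range (R + 1),
          altCoeff q r * (X ^ r * C q ^ r ^ 2) ^ (p + 1) * (1 - X * C q ^ (2 * r)) *
            baileyBasis q X r s := by
      intro s hs
      rw [ih s (by omega) (by simpa [Nat.lt_succ_iff] using hs)]
      simp
    rw [Finset.sum_congr rfl h, sum_mul_sum_baileyBasis q (by simp) _ n (R + 1) (by omega)]
    refine Finset.sum_congr rfl fun r _ => ?_
    ring

theorem chainSum_add (R a j n : ℕ) (hn : n < R) :
    chainSum q R a (a + j) n = ∑ r ∈ Finset.range R,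
      altCoeff q r * C q ^ r * ((X ^ r * C q ^ r ^ 2) ^ (a + 1) -
        (X ^ (r + 1) * C q ^ (r + 1) ^ 2) ^ (a + 1)) * ((X * C q) ^ r * C q ^ r ^ 2) ^ j *
        baileyBasis q (X * C q) r n := by
  induction j generalizing n with
  | zero =>
    have hs := sum_altCoeff_succ q (y := X) (by simp)
      (fun r => (X ^ r * C q ^ r ^ 2) ^ (a + 1)) n R hn
    simp only [pow_zero, mul_one, add_zero]
    rw [← hs]
    cases a with
    | zero =>
      simpa [chainSum] using
        (sum_altCoeff_eq_one q (y := X) (by simp) (n + 1) (R + 1) (by omega)).symm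
    | succ k =>
      rw [chainSum]
      simp only [if_pos (Nat.lt_succ_self k), if_neg (show ¬k + 1 ≤ k by omega), if_true]
      have h : ∀ s ∈ Finset.range (R + 1),
          X ^ s * C q ^ (s ^ 2 + 0) * C (qBinom q (n + 1) s) * chainSum q R (k + 1) k s =
          X ^ s * C q ^ s ^ 2 * C (qBinom q (n + 1) s) * ∑ r ∈ Finset.range (R + 1),
            altCoeff q r * (X ^ r * C q ^ r ^ 2) ^ (k + 1) * (1 - X * C q ^ (2 * r)) *
              baileyBasis q X r s := by
        intro s hs
        rw [chainSum_of_lt q R _ k s (by omega) (by simpa [Nat.lt_succ_iff] using hs)]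
        simp
      rw [Finset.sum_congr rfl h, sum_mul_sum_baileyBasis q (by simp) _ (n + 1) (R + 1) (by omega)]
      refine Finset.sum_congr rfl fun r _ => ?_
      ring
  | succ j ih =>
    rw [← add_assoc, chainSum]
    simp only [if_neg (show ¬a + j < a by omega), if_pos (show a ≤ a + j by omega),
      if_neg (show a + j + 1 ≠ a by omega)]
    have h : ∀ s ∈ Finset.range R,
        X ^ s * C q ^ (s ^ 2 + s) * C (qBinom q (n + 0) s) * chainSum q R a (a + j) s =
        (X * C q) ^ s * C q ^ s ^ 2 * C (qBinom q n s) * ∑ r ∈ Finset.range R,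
          altCoeff q r * C q ^ r * ((X ^ r * C q ^ r ^ 2) ^ (a + 1) -
            (X ^ (r + 1) * C q ^ (r + 1) ^ 2) ^ (a + 1)) * ((X * C q) ^ r * C q ^ r ^ 2) ^ j *
          baileyBasis q (X * C q) r s := by
      intro s hs
      rw [ih s (by simpa using hs)]
      rw [add_zero]
      ring
    rw [Finset.sum_congr rfl h, sum_mul_sum_baileyBasis q (by simp) _ n R hn]
    refine Finset.sum_congr rfl fun r _ => ?_
    ring

theorem altCoeff_mul_lastWeight (r : ℕ) :
    altCoeff q r * C q ^ r * lastWeight q r = X ^ r * C q ^ (r ^ 2 + r) := by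
  induction r with
  | zero => simp [altCoeff, lastWeight]
  | succ r ih =>
    rw [altCoeff_succ, lastWeight_succ]
    linear_combination X * C q ^ (2 * r + 2) * ih

theorem X_pow_dvd_sum_chainSum (R a j : ℕ) :
    X ^ R ∣ ∑ n ∈ Finset.range R, lastWeight q n * chainSum q R a (a + j) n -
      ∑ r ∈ Finset.range R,
        (X ^ ((a + j + 2) * r) * C q ^ ((a + j + 2) * r ^ 2 + (j + 1) * r) -
          X ^ ((a + j + 2) * r + a + 1) *
            C q ^ ((a + j + 2) * r ^ 2 + (2 * a + j + 3) * r + 1 + a)) := by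
  set l : ℕ → ℂ⟦X⟧ := fun r => altCoeff q r * C q ^ r * ((X ^ r * C q ^ r ^ 2) ^ (a + 1) -
        (X ^ (r + 1) * C q ^ (r + 1) ^ 2) ^ (a + 1)) * ((X * C q) ^ r * C q ^ r ^ 2) ^ j with hl
  have h1 : ∑ n ∈ Finset.range R, lastWeight q n * chainSum q R a (a + j) n =
      ∑ r ∈ Finset.range R, l r *
        ∑ n ∈ Finset.range R, lastWeight q n * baileyBasis q (X * C q) r n := by
    simp_rw [Finset.mul_sum]
    rw [Finset.sum_comm]
    refine Finset.sum_congr rfl fun n hn => ?_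
    rw [chainSum_add q R a j n (by simpa using hn), Finset.mul_sum]
    refine Finset.sum_congr rfl fun r _ => ?_
    simp only [hl]
    ring
  rw [h1, ← Finset.sum_sub_distrib]
  refine Finset.dvd_sum fun r _ => ?_
  have h2 : X ^ ((a + j + 2) * r) * C q ^ ((a + j + 2) * r ^ 2 + (j + 1) * r) -
          X ^ ((a + j + 2) * r + a + 1) *
            C q ^ ((a + j + 2) * r ^ 2 + (2 * a + j + 3) * r + 1 + a) =
      l r * lastWeight q r := by
    simp only [hl]
    linear_combination -((X ^ r * C q ^ r ^ 2) ^ (a + 1) -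
        (X ^ (r + 1) * C q ^ (r + 1) ^ 2) ^ (a + 1)) * ((X * C q) ^ r * C q ^ r ^ 2) ^ j *
        altCoeff_mul_lastWeight q r
  rw [h2, ← mul_sub]
  exact (X_pow_dvd_sum_lastWeight q r R).mul_left _

end chain

section box

variable (q : ℂ)

theorem sum_piFinset_snoc {A : Type*} [AddCommMonoid A] {p : ℕ} (S : Fin (p + 1) → Finset ℕ)
    (f : (Fin (p + 1) → ℕ) → A) :
    ∑ c ∈ Fintype.piFinset S, f c =
      ∑ r ∈ S (Fin.last p), ∑ c ∈ Fintype.piFinset fun j : Fin p => S j.castSucc,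
        f (Fin.snoc c r) := by
  rw [← Finset.sum_product']
  symm
  refine Finset.sum_equiv (Fin.snocEquiv fun _ => ℕ) (fun x => ?_) (fun x _ => rfl)
  simp [Fin.forall_fin_succ', and_comm, Fin.snocEquiv]

/-- The summand of `Kterm` without the factors of the last variable, times the power of `X`. -/
noncomputable def chainTerm (p a : ℕ) (d : Fin (p + 1) → ℕ) : ℂ⟦X⟧ :=
  X ^ (∑ j : Fin p, d j.castSucc) *
    C q ^ ((∑ j : Fin p, (d j.castSucc) ^ 2) +
          ∑ j : Fin p, (if a ≤ (j : ℕ) then d j.castSucc else 0)) *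
    ∏ j : Fin p, C (qBinom q (d j.succ + (if (j : ℕ) + 1 = a then 1 else 0)) (d j.castSucc))

theorem chainTerm_snoc (p a n : ℕ) (e : Fin (p + 1) → ℕ) :
    chainTerm q (p + 1) a (Fin.snoc e n : Fin (p + 2) → ℕ) =
      X ^ e (Fin.last p) * C q ^ (e (Fin.last p) ^ 2 + if a ≤ p then e (Fin.last p) else 0) *
        C (qBinom q (n + if p + 1 = a then 1 else 0) (e (Fin.last p))) * chainTerm q p a e := by
  have h (i : Fin p) : (Fin.snoc e n : Fin (p + 2) → ℕ) i.castSucc.succ = e i.succ := by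
    rw [← Fin.castSucc_succ, Fin.snoc_castSucc]
  have h' : (Fin.snoc e n : Fin (p + 2) → ℕ) (Fin.last p).succ = n := by
    rw [Fin.succ_last, Fin.snoc_last]
  simp only [chainTerm, Fin.snoc_castSucc]
  rw [Fin.sum_univ_castSucc, Fin.sum_univ_castSucc, Fin.sum_univ_castSucc,
    Fin.prod_univ_castSucc]
  simp only [h, h', Fin.val_castSucc, Fin.val_last]
  ring

theorem chainSum_eq_sum (R a p n : ℕ) :
    chainSum q R a p n =
      ∑ c ∈ Fintype.piFinset fun j : Fin p => Finset.range (if (j : ℕ) < a then R + 1 else R),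
        chainTerm q p a (Fin.snoc c n) := by
  induction p generalizing n with
  | zero => simp [chainSum, chainTerm]
  | succ p ih =>
    rw [chainSum, sum_piFinset_snoc]
    simp only [Fin.val_castSucc, Fin.val_last]
    refine Finset.sum_congr rfl fun r _ => ?_
    rw [ih, Finset.mul_sum]
    refine Finset.sum_congr rfl fun c _ => ?_
    rw [chainTerm_snoc, Fin.snoc_last]

theorem C_Kterm_mul_X_pow (p a : ℕ) (d : Fin (p + 1) → ℕ) :
    C (Kterm p a q 1 d) * X ^ (∑ j, d j) =
      lastWeight q (d (Fin.last p)) * chainTerm q p a d := by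
  rw [Kterm, chainTerm, lastWeight, Fin.sum_univ_castSucc, Nat.choose_two_right,
    Nat.add_sub_cancel, mul_comm (d (Fin.last p) + 1)]
  simp only [one_pow, mul_one, map_mul, map_pow, map_neg, map_one, map_prod]
  ring

/-- The box containing all `c` with `c_1 + ⋯ + c_{p+1} < R`. -/
def chainBox (R a p : ℕ) : Finset (Fin (p + 1) → ℕ) :=
  Fintype.piFinset fun j => Finset.range (if (j : ℕ) < a then R + 1 else R)

theorem mem_chainBox {R a p : ℕ} {c : Fin (p + 1) → ℕ} (h : ∑ j, c j < R) :
    c ∈ chainBox R a p := by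
  rw [chainBox, Fintype.mem_piFinset]
  intro j
  have := Finset.single_le_sum (f := c) (fun _ _ => Nat.zero_le _) (Finset.mem_univ j)
  rw [Finset.mem_range]
  split_ifs <;> omega

theorem sum_chainBox (R a j : ℕ) :
    ∑ c ∈ chainBox R a (a + j), C (Kterm (a + j) a q 1 c) * X ^ (∑ i, c i) =
      ∑ n ∈ Finset.range R, lastWeight q n * chainSum q R a (a + j) n := by
  rw [chainBox, sum_piFinset_snoc]
  simp only [Fin.val_castSucc, Fin.val_last, if_neg (show ¬a + j < a by omega), chainSum_eq_sum,
    Finset.mul_sum]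
  refine Finset.sum_congr rfl fun r _ => Finset.sum_congr rfl fun c _ => ?_
  rw [C_Kterm_mul_X_pow, Fin.snoc_last]

theorem sum_filter_chainBox (a j N : ℕ) :
    ∑ c ∈ chainBox (N + 1) a (a + j) with ∑ i, c i = N, Kterm (a + j) a q 1 c =
      ∑ k ∈ Finset.range (N + 1), (if N = (a + j + 2) * k then
          q ^ ((a + j + 2) * k ^ 2 + (j + 1) * k) else 0) -
      ∑ k ∈ Finset.range (N + 1), (if N = (a + j + 2) * k + a + 1 then
          q ^ ((a + j + 2) * k ^ 2 + (2 * a + j + 3) * k + 1 + a) else 0) := by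
  have h := X_pow_dvd_iff.1 (X_pow_dvd_sum_chainSum q (N + 1) a j) N (Nat.lt_succ_self N)
  rw [← sum_chainBox, map_sub, sub_eq_zero, map_sum, map_sum] at h
  have h1 (c : Fin (a + j + 1) → ℕ) : coeff N (C (Kterm (a + j) a q 1 c) * X ^ (∑ i, c i)) =
      if ∑ i, c i = N then Kterm (a + j) a q 1 c else 0 := by
    rw [coeff_C_mul, coeff_X_pow]
    simp [eq_comm]
  have h2 (e f : ℕ) : coeff N (X ^ e * C q ^ f) = if N = e then q ^ f else 0 := by
    rw [← map_pow, coeff_mul_C, coeff_X_pow]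
    simp
  simp only [h1, map_sub, h2, Finset.sum_sub_distrib] at h
  rw [Finset.sum_filter, h]

end box

section summability

theorem summable_pi_prod {h : ℕ → ℝ} (h0 : ∀ k, 0 ≤ h k) (hs : Summable h) (p : ℕ) :
    Summable fun c : Fin p → ℕ => ∏ j, h (c j) := by
  induction p with
  | zero => exact Summable.of_finite
  | succ p ih =>
    rw [← (Fin.consEquiv fun _ => ℕ).summable_iff]
    have := hs.mul_of_nonneg ih h0 fun c => Finset.prod_nonneg fun j _ => h0 _
    refine this.congr fun x => ?_
    simp [Fin.consEquiv, Fin.prod_univ_succ]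

theorem summable_triangle_pow_mul_pow {x D : ℝ} (hx0 : 0 < x) (hx1 : x < 1) (hD : 0 < D) :
    Summable fun k : ℕ => x ^ (k + 1).choose 2 * D ^ k := by
  refine summable_of_ratio_test_tendsto_lt_one (l := 0) one_pos
    (Filter.Eventually.of_forall fun k => by positivity) ?_
  have h : (fun k : ℕ => ‖x ^ (k + 1 + 1).choose 2 * D ^ (k + 1)‖ / ‖x ^ (k + 1).choose 2 * D ^ k‖)
      = fun k => x ^ k * (x * D) := by
    funext k
    rw [Real.norm_of_nonneg (by positivity), Real.norm_of_nonneg (by positivity),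
      Nat.choose_succ_succ' (k + 1) 1, Nat.choose_one_right]
    field_simp
    ring
  rw [h]
  simpa using (tendsto_pow_atTop_nhds_zero_of_lt_one hx0.le hx1).mul_const (x * D)

theorem norm_Kterm_le (p a : ℕ) {q : ℂ} (hq1 : ‖q‖ < 1) (c : Fin (p + 1) → ℕ) :
    ‖Kterm p a q 1 c‖ ≤ ∏ j, ‖q‖ ^ (c j + 1).choose 2 * ((1 - ‖q‖)⁻¹) ^ c j := by
  have hD : 1 ≤ (1 - ‖q‖)⁻¹ := one_le_inv_iff₀.2 ⟨by linarith, by linarith [norm_nonneg q]⟩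
  have hlast : ‖q‖ ^ (c (Fin.last p) * (c (Fin.last p) + 1) / 2) ≤
      ‖q‖ ^ (c (Fin.last p) + 1).choose 2 * ((1 - ‖q‖)⁻¹) ^ c (Fin.last p) := by
    rw [Nat.choose_two_right, Nat.add_sub_cancel, mul_comm (c (Fin.last p) + 1)]
    exact le_mul_of_one_le_right (by positivity) (one_le_pow₀ hD)
  have hinit : ‖q‖ ^ (∑ j : Fin p, c j.castSucc ^ 2) *
      ∏ j : Fin p, ((1 - ‖q‖)⁻¹) ^ c j.castSucc ≤
      ∏ j : Fin p, ‖q‖ ^ (c j.castSucc + 1).choose 2 * ((1 - ‖q‖)⁻¹) ^ c j.castSucc := by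
    rw [← Finset.prod_pow_eq_pow_sum, ← Finset.prod_mul_distrib]
    refine Finset.prod_le_prod (fun j _ => by positivity) fun j _ => ?_
    gcongr ?_ * _
    refine pow_le_pow_of_le_one (norm_nonneg q) hq1.le ?_
    rw [Nat.choose_two_right, Nat.add_sub_cancel]
    refine Nat.div_le_of_le_mul ?_
    nlinarith [Nat.le_self_pow two_ne_zero (c j.castSucc)]
  rw [Fin.prod_univ_castSucc, Kterm]
  simp only [norm_mul, norm_pow, norm_neg, norm_one, one_pow, one_mul, mul_one, norm_prod]
  calc _ ≤ ‖q‖ ^ (c (Fin.last p) * (c (Fin.last p) + 1) / 2) *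
        ‖q‖ ^ (∑ j : Fin p, c j.castSucc ^ 2) *
        ∏ j : Fin p, ((1 - ‖q‖)⁻¹) ^ c j.castSucc := by
        gcongr ?_ * ?_ * ?_
        · exact pow_le_pow_of_le_one (norm_nonneg q) hq1.le (Nat.le_add_right _ _)
        · exact Finset.prod_le_prod (fun j _ => norm_nonneg _) fun j _ => norm_qBinom_le q hq1 _ _
    _ ≤ _ := by
        rw [mul_assoc, mul_comm]
        gcongr

theorem summable_mul_Kterm (p a b : ℕ) {q : ℂ} (hq0 : q ≠ 0) (hq1 : ‖q‖ < 1) :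
    Summable fun c : Fin (p + 1) → ℕ =>
      ((2 * (∑ j, c j) + b : ℕ) : ℂ) * Kterm p a q 1 c := by
  have h0 : 0 < ‖q‖ := norm_pos_iff.2 hq0
  have h1 : 0 < (1 - ‖q‖)⁻¹ := inv_pos.2 (by linarith)
  have hs := (summable_pi_prod (fun k => by positivity)
    (summable_triangle_pow_mul_pow h0 hq1 (mul_pos two_pos h1)) (p + 1)).mul_left (2 + b : ℝ)
  refine Summable.of_norm_bounded hs fun c => ?_
  have h2 : ((2 * (∑ j, c j) + b : ℕ) : ℝ) ≤ (2 + b) * ∏ j, (2 : ℝ) ^ c j := by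
    rw [Finset.prod_pow_eq_pow_sum]
    have e1 : ((∑ j, c j : ℕ) : ℝ) ≤ 2 ^ ∑ j, c j := by exact_mod_cast Nat.lt_two_pow_self.le
    have e2 : (1 : ℝ) ≤ 2 ^ ∑ j, c j := one_le_pow₀ one_le_two
    rw [Nat.cast_add, Nat.cast_mul, Nat.cast_ofNat]
    nlinarith [mul_le_mul_of_nonneg_left e2 (Nat.cast_nonneg (α := ℝ) b)]
  rw [norm_mul, Complex.norm_natCast]
  calc _ ≤ ((2 + b) * ∏ j, (2 : ℝ) ^ c j) *
        ∏ j, ‖q‖ ^ (c j + 1).choose 2 * ((1 - ‖q‖)⁻¹) ^ c j :=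
        mul_le_mul h2 (norm_Kterm_le p a hq1 c) (norm_nonneg _) (by positivity)
    _ = _ := by
        rw [mul_assoc, ← Finset.prod_mul_distrib]
        congr 1
        refine Finset.prod_congr rfl fun j _ => ?_
        rw [mul_pow]
        ring

theorem summable_linear_mul_pow {q : ℂ} (hq1 : ‖q‖ < 1) (b d : ℕ) {e : ℕ → ℕ}
    (he : ∀ k, k ≤ e k) : Summable fun k : ℕ => ((b * k + d : ℕ) : ℂ) * q ^ e k := by
  have h1 := (summable_pow_mul_geometric_of_norm_lt_one 1 (r := ‖q‖) (by simpa using hq1)).mul_left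
    (b : ℝ)
  have h2 := (summable_geometric_of_lt_one (norm_nonneg q) hq1).mul_left (d : ℝ)
  refine Summable.of_norm_bounded (h1.add h2) fun k => ?_
  rw [norm_mul, norm_pow, Complex.norm_natCast]
  calc _ ≤ ((b * k + d : ℕ) : ℝ) * ‖q‖ ^ k := by
        exact mul_le_mul_of_nonneg_left (pow_le_pow_of_le_one (norm_nonneg q) hq1.le (he k))
          (Nat.cast_nonneg _)
    _ = _ := by push_cast; ring

theorem sum_ite_eq_extend {f : ℕ → ℂ} {g : ℕ → ℕ} (hg : g.Injective) (hk : ∀ k, k ≤ g k) (N : ℕ) :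
    ∑ k ∈ Finset.range (N + 1), (if N = g k then f k else 0) = Function.extend g f 0 N := by
  by_cases h : ∃ k, g k = N
  · obtain ⟨k, rfl⟩ := h
    rw [hg.extend_apply, Finset.sum_eq_single_of_mem k
      (Finset.mem_range.2 (Nat.lt_succ_of_le (hk k)))]
    · simp
    · intro l _ hl
      rw [if_neg fun h => hl (hg h).symm]
  · rw [Function.extend_apply' _ _ _ h]
    exact Finset.sum_eq_zero fun k _ => if_neg fun h' => h ⟨k, h'.symm⟩

end summability

theorem tsum_fiber_mul_Kterm (q : ℂ) (a j N : ℕ) :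
    (∑' c : (fun c : Fin (a + j + 1) → ℕ => ∑ i, c i) ⁻¹' {N},
        ((2 * (∑ i, (c : Fin (a + j + 1) → ℕ) i) + (j + 1) : ℕ) : ℂ) * Kterm (a + j) a q 1 c) =
      Function.extend (fun k => (a + j + 2) * k) (fun k =>
          ((2 * (a + j + 2) * k + (j + 1) : ℕ) : ℂ) *
            q ^ ((a + j + 2) * k ^ 2 + (j + 1) * k)) 0 N -
        Function.extend (fun k => (a + j + 2) * k + a + 1) (fun k =>
          ((2 * (a + j + 2) * k + (2 * a + j + 3) : ℕ) : ℂ) *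
            q ^ ((a + j + 2) * k ^ 2 + (2 * a + j + 3) * k + 1 + a)) 0 N := by
  have hg : (fun k : ℕ => (a + j + 2) * k).Injective := mul_right_injective₀ (by omega)
  have hset : (fun c : Fin (a + j + 1) → ℕ => ∑ i, c i) ⁻¹' {N} =
      ((chainBox (N + 1) a (a + j)).filter fun c => ∑ i, c i = N : Finset _) := by
    ext c
    simp only [Set.mem_preimage, Set.mem_singleton_iff, Finset.coe_filter, Set.mem_ofPred_eq]
    exact ⟨fun h => ⟨mem_chainBox (by omega), h⟩, And.right⟩
  rw [hset, Finset.tsum_subtype' _ fun c : Fin (a + j + 1) → ℕ =>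
    ((2 * (∑ i, c i) + (j + 1) : ℕ) : ℂ) * Kterm (a + j) a q 1 c]
  have hfac : ∀ c ∈ (chainBox (N + 1) a (a + j)).filter fun c => ∑ i, c i = N,
      ((2 * (∑ i, c i) + (j + 1) : ℕ) : ℂ) * Kterm (a + j) a q 1 c =
        ((2 * N + (j + 1) : ℕ) : ℂ) * Kterm (a + j) a q 1 c := fun c hc => by
    rw [(Finset.mem_filter.1 hc).2]
  rw [Finset.sum_congr rfl hfac, ← Finset.mul_sum, sum_filter_chainBox, mul_sub, Finset.mul_sum,
    Finset.mul_sum, ← sum_ite_eq_extend hg fun k => by nlinarith,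
    ← sum_ite_eq_extend (fun x y h => hg (by simpa using h)) fun k => by nlinarith]
  congr 1 <;> refine Finset.sum_congr rfl fun k _ => ?_ <;> rw [mul_ite, mul_zero] <;>
    refine if_congr Iff.rfl rfl rfl |>.trans ?_ <;> split_ifs with h
  · rw [h, ← mul_assoc]
  · rfl
  · rw [h]
    congr 2
    ring
  · rfl

/-- for `m ≥ 2` (`m = p+2`), `0 ≤ a ≤ m−2` and `0 < |q| < 1`,
`Σ_{k≥0} [(2mk+m−1−a) q^{mk²+(m−1−a)k} − (2mk+m+1+a) q^{mk²+(m+1+a)k+1+a}]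
 = Σ_{c_1,…,c_{m−1}≥0} (2(c_1+⋯+c_{m−1})+m−1−a) (−1)^{c_{m−1}}
     q^{c_{m−1}(c_{m−1}+1)/2} q^{c_1²+⋯+c_{m−2}²+c_{a+1}+⋯+c_{m−2}}
     Π_{i=1}^{m−2} [c_{i+1}+δ_{i,a} choose c_i]_q`
(the right-hand terms are `(2 Σᵢ cᵢ + m−1−a)` times the terms of `K_m^{(a)}(1)`). -/
theorem stmt9 (m p a : ℕ) (hm : m = p + 2) (ha : a ≤ m - 2) (q : ℂ)
    (hq0 : q ≠ 0) (hq1 : ‖q‖ < 1) :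
    (∑' k : ℕ,
        (((2 * m * k + (m - 1 - a) : ℕ) : ℂ) * q ^ (m * k ^ 2 + (m - 1 - a) * k) -
          ((2 * m * k + (m + 1 + a) : ℕ) : ℂ) * q ^ (m * k ^ 2 + (m + 1 + a) * k + 1 + a))) =
      ∑' c : Fin (p + 1) → ℕ,
        ((2 * (∑ j : Fin (p + 1), c j) + (m - 1 - a) : ℕ) : ℂ) * Kterm p a q 1 c := by
  subst hm
  obtain ⟨j, rfl⟩ : ∃ j, p = a + j := ⟨p - a, by omega⟩
  rw [show a + j + 2 - 1 - a = j + 1 by omega, show a + j + 2 + 1 + a = 2 * a + j + 3 by omega]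
  have hs := summable_mul_Kterm (a + j) a (j + 1) hq0 hq1
  have hs1 := summable_linear_mul_pow hq1 (2 * (a + j + 2)) (j + 1)
    (e := fun k => (a + j + 2) * k ^ 2 + (j + 1) * k) fun k => by nlinarith
  have hs2 := summable_linear_mul_pow hq1 (2 * (a + j + 2)) (2 * a + j + 3)
    (e := fun k => (a + j + 2) * k ^ 2 + (2 * a + j + 3) * k + 1 + a) fun k => by nlinarith
  have hg1 : (fun k : ℕ => (a + j + 2) * k).Injective :=
    mul_right_injective₀ (by omega)
  have hg2 : (fun k : ℕ => (a + j + 2) * k + a + 1).Injective := fun x y h =>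
    hg1 (by simpa using h)
  rw [hs1.tsum_sub hs2]
  refine HasSum.unique (((hasSum_extend_zero hg1).2 hs1.hasSum).sub
    ((hasSum_extend_zero hg2).2 hs2.hasSum)) ?_
  convert hs.hasSum.tsum_fiberwise fun c => ∑ i, c i using 1
  funext N
  exact (tsum_fiber_mul_Kterm q a j N).symm
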